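/- Let d ≥ 1, s ∈ (0,2] and L > 0. There exists a constant C depending only on s, L and d such that the following holds. If f : ℝ^d → ℝ is nonnegative and (s,L)-Hölder (i.e. |f(x) − f(y)| ≤ L‖x−y‖^s for all x,y when s ∈ (0,1], and f is continuously differentiable with ‖∇f(x) − ∇f(y)‖ ≤ L‖x−y‖^{s−1} for all x,y when s ∈ (1,2]), then for every x ∈ ℝ^d and every t > 0, f(x) ≤ C · max{ f_t(x), ( f_t(x) V_d t^d )^{s/(s+d)} }. -/

import Mathlib

open MeasureTheory Real

noncomputable section

abbrev Euc (d : ℕ) : Type := EuclideanSpace ℝ (Fin d)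

/-- Volume of the unit Euclidean ball in `ℝ^d`. -/
def unitBallVol (d : ℕ) : ℝ := Real.pi ^ ((d : ℝ) / 2) / Real.Gamma (1 + (d : ℝ) / 2)

/-- `f_t(x)`: the average of `f` over the closed Euclidean ball `B(x,t)`. -/
def ballAvg (d : ℕ) (f : Euc d → ℝ) (t : ℝ) (x : Euc d) : ℝ :=
  (1 / (unitBallVol d * t ^ d)) * ∫ u in Metric.closedBall x t, f u

end

noncomputable section

/-- `(s,L)`-Hölder condition for `s ∈ (0,2]`. -/
def IsHolderOrder (d : ℕ) (s L : ℝ) (f : Euc d → ℝ) : Prop :=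
  if s ≤ 1 then
    ∀ x y : Euc d, |f x - f y| ≤ L * ‖x - y‖ ^ s
  else
    ContDiff ℝ 1 f ∧ ∀ x y : Euc d, ‖gradient f x - gradient f y‖ ≤ L * ‖x - y‖ ^ (s - 1)

/-- The second symmetric difference of an `(s,L)`-Hölder function is at least `-2Lr^s` at scale
`r`. -/
theorem IsHolderOrder.two_mul_sub_le_add_reflection {d : ℕ} {s L : ℝ} {f : Euc d → ℝ}
    (hf : IsHolderOrder d s L f) (hs : 0 < s) (hL : 0 < L) {x u : Euc d} {r : ℝ} (hr : 0 < r)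
    (hu : u ∈ Metric.closedBall x r) :
    2 * (f x - L * r ^ s) ≤ f u + f (x + x - u) := by
  have hu1 : ‖u - x‖ ≤ r := by simpa [dist_eq_norm] using hu
  have hv1 : ‖x + x - u - x‖ ≤ r := by
    rw [show x + x - u - x = -(u - x) by abel, norm_neg]
    exact hu1
  unfold IsHolderOrder at hf
  split_ifs at hf with h1
  · have key : ∀ v : Euc d, ‖v - x‖ ≤ r → f x - L * r ^ s ≤ f v := fun v hv => by
      have h2 := (abs_le.1 (hf v x)).1
      have h3 : L * ‖v - x‖ ^ s ≤ L * r ^ s := by gcongr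
      linarith
    linarith [key u hu1, key _ hv1]
  · obtain ⟨hc, hg⟩ := hf
    have hdiff : Differentiable ℝ f := hc.differentiable one_ne_zero
    have key : ∀ v : Euc d, ‖v - x‖ ≤ r → -(L * r ^ s) ≤ f v - f x - fderiv ℝ f x (v - x) :=
      fun v hv => by
      have hb : ∀ y ∈ Metric.closedBall x r, ‖fderiv ℝ f y - fderiv ℝ f x‖ ≤ L * r ^ (s - 1) := by
        intro y hy
        have hy' : ‖y - x‖ ≤ r := by simpa [dist_eq_norm] using hy
        have e : ‖fderiv ℝ f y - fderiv ℝ f x‖ = ‖gradient f y - gradient f x‖ := by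
          simp only [gradient]
          rw [← map_sub, LinearIsometryEquiv.norm_map]
        rw [e]
        refine (hg y x).trans ?_
        have : 0 ≤ s - 1 := by linarith
        gcongr
      have h2 := (convex_closedBall x r).norm_image_sub_le_of_norm_hasFDerivWithin_le'
        (f := f) (φ := fderiv ℝ f x)
        (fun y _ => (hdiff y).hasFDerivAt.hasFDerivWithinAt) hb
        (Metric.mem_closedBall_self hr.le) (show v ∈ Metric.closedBall x r by
          simpa [dist_eq_norm] using hv)
      have h3 : L * r ^ (s - 1) * ‖v - x‖ ≤ L * r ^ s := by
        calc L * r ^ (s - 1) * ‖v - x‖ ≤ L * r ^ (s - 1) * r := by gcongr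
          _ = L * r ^ s := by
            rw [rpow_sub_one hr.ne']
            field_simp
      exact (abs_le.1 (h2.trans h3)).1
    have h4 := key _ hv1
    rw [show x + x - u - x = -(u - x) by abel, map_neg] at h4
    linarith [key u hu1]

theorem IsHolderOrder.continuous {d : ℕ} {s L : ℝ} {f : Euc d → ℝ}
    (hf : IsHolderOrder d s L f) (hs : 0 < s) (hL : 0 < L) : Continuous f := by
  unfold IsHolderOrder at hf
  split_ifs at hf with h1
  · have h : HolderWith L.toNNReal s.toNNReal f := by
      intro x y
      have h2 := ENNReal.ofReal_le_ofReal (hf x y)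
      rw [ENNReal.ofReal_mul hL.le, ← ENNReal.ofReal_rpow_of_nonneg (norm_nonneg _) hs.le,
        ← dist_eq_norm, ← Real.dist_eq, ← edist_dist, ← edist_dist] at h2
      simpa [Real.coe_toNNReal _ hs.le, ENNReal.ofReal] using h2
    exact h.continuous (by simpa using hs)
  · exact hf.1.continuous

theorem unitBallVol_pos (d : ℕ) : 0 < unitBallVol d :=
  div_pos (by positivity) (Gamma_pos_of_pos (by positivity))

theorem volume_real_closedBall_eq {d : ℕ} (hd : 1 ≤ d) (x : Euc d) {r : ℝ} (hr : 0 ≤ r) :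
    volume.real (Metric.closedBall x r) = unitBallVol d * r ^ d := by
  have : Nonempty (Fin d) := ⟨⟨0, hd⟩⟩
  have hG : 0 < Gamma ((d : ℝ) / 2 + 1) := Gamma_pos_of_pos (by positivity)
  rw [Measure.real, EuclideanSpace.volume_closedBall, ENNReal.toReal_mul, ENNReal.toReal_pow,
    ENNReal.toReal_ofReal hr, Fintype.card_fin, ENNReal.toReal_ofReal (by positivity),
    unitBallVol, sqrt_eq_rpow, ← rpow_natCast (π ^ (1 / 2 : ℝ)), ← rpow_mul pi_nonneg,
    one_div_mul_eq_div, add_comm (1 : ℝ), mul_comm]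

/-- The integral over a ball of an `(s,L)`-Hölder function is bounded below by its value at the
centre, up to the Hölder error. -/
theorem IsHolderOrder.volume_mul_le_setIntegral {d : ℕ} (hd : 1 ≤ d) {s L : ℝ} {f : Euc d → ℝ}
    (hf : IsHolderOrder d s L f) (hs : 0 < s) (hL : 0 < L) (x : Euc d) {r : ℝ} (hr : 0 < r) :
    unitBallVol d * r ^ d * (f x - L * r ^ s) ≤ ∫ u in Metric.closedBall x r, f u := by
  have hc := hf.continuous hs hL
  have hc' : Continuous fun u => f (x + x - u) := by fun_prop
  have hK := isCompact_closedBall x r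
  have hpre : (fun u => x + x - u) ⁻¹' Metric.closedBall x r = Metric.closedBall x r := by
    ext u
    simp only [Set.mem_preimage, Metric.mem_closedBall, dist_eq_norm]
    rw [show x + x - u - x = -(u - x) by abel, norm_neg]
  have hrefl : ∫ u in Metric.closedBall x r, f (x + x - u) = ∫ u in Metric.closedBall x r, f u := by
    have := (Measure.measurePreserving_sub_left (volume : Measure (Euc d)) (x + x)).setIntegral_preimage_emb
      (Homeomorph.subLeft (x + x)).measurableEmbedding f (Metric.closedBall x r)
    rwa [hpre] at this
  have hmono : ∫ _ in Metric.closedBall x r, 2 * (f x - L * r ^ s) ≤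
      ∫ u in Metric.closedBall x r, (f u + f (x + x - u)) :=
    setIntegral_mono_on (continuous_const.continuousOn.integrableOn_compact hK)
      ((hc.add hc').continuousOn.integrableOn_compact hK) measurableSet_closedBall
      fun u hu => hf.two_mul_sub_le_add_reflection hs hL hr hu
  rw [integral_add (hc.continuousOn.integrableOn_compact hK)
    (hc'.continuousOn.integrableOn_compact hK), hrefl, setIntegral_const, smul_eq_mul,
    volume_real_closedBall_eq hd x hr.le] at hmono
  linarith

/-- A nonnegative `(s,L)`-Hölder function is pointwise controlled by
its ball averages: `f(x) ≤ C max{f_t(x), (f_t(x) V_d t^d)^{s/(s+d)}}`. -/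
theorem self_le_max_ballAvg (d : ℕ) (hd : 1 ≤ d) (s L : ℝ)
    (hs : 0 < s) (hs2 : s ≤ 2) (hL : 0 < L) :
    ∃ C : ℝ, 0 < C ∧ ∀ f : Euc d → ℝ, (∀ x, 0 ≤ f x) → IsHolderOrder d s L f →
      ∀ (x : Euc d) (t : ℝ), 0 < t →
        f x ≤ C * max (ballAvg d f t x)
          ((ballAvg d f t x * (unitBallVol d * t ^ d)) ^ (s / (s + d))) := by
  set V := unitBallVol d with hVdef
  have hV : 0 < V := unitBallVol_pos d
  have hd0 : (0 : ℝ) < d := by exact_mod_cast hd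
  set K : ℝ := 2 * (2 * L) ^ (d / s : ℝ) / V with hK
  have hK0 : 0 < K := by positivity
  refine ⟨2 + K ^ (s / (s + d)), by positivity, fun f hf0 hf x t ht => ?_⟩
  have hA : ballAvg d f t x * (V * t ^ d) = ∫ u in Metric.closedBall x t, f u := by
    rw [ballAvg, ← hVdef]
    field_simp
  have hI0 : 0 ≤ ∫ u in Metric.closedBall x t, f u := integral_nonneg hf0
  rw [hA]
  set I := ∫ u in Metric.closedBall x t, f u with hI
  have hB0 : 0 ≤ ballAvg d f t x := by
    rw [ballAvg, ← hVdef, ← hI]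
    positivity
  rw [add_mul]
  have hp : 0 ≤ I ^ (s / (s + d)) := by positivity
  rcases (hf0 x).eq_or_lt with hx | hx
  · rw [← hx]
    have := le_max_of_le_left (c := I ^ (s / (s + d))) hB0
    positivity
  rcases le_total (L * t ^ s) (f x / 2) with h | h
  · have h1 := hf.volume_mul_le_setIntegral hd hs hL x ht
    have h2 : f x / 2 ≤ ballAvg d f t x := by
      have : V * t ^ d * (f x / 2) ≤ V * t ^ d * ballAvg d f t x := by
        rw [mul_comm _ (ballAvg d f t x), hA]
        refine le_trans ?_ h1
        gcongr
        linarith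
      exact le_of_mul_le_mul_left this (by positivity)
    have h3 := le_max_left (ballAvg d f t x) (I ^ (s / (s + d)))
    have : 0 ≤ K ^ (s / (s + d)) * max (ballAvg d f t x) (I ^ (s / (s + d))) :=
      mul_nonneg (by positivity) (hB0.trans h3)
    linarith
  · set r : ℝ := (f x / (2 * L)) ^ (1 / s : ℝ) with hr
    have hr0 : 0 < r := by positivity
    have hrs : r ^ s = f x / (2 * L) := by
      rw [hr, ← rpow_mul (by positivity), one_div_mul_cancel hs.ne', rpow_one]
    have hrt : r ≤ t := by
      rw [← rpow_le_rpow_iff hr0.le ht.le hs, hrs, div_le_iff₀ (by positivity)]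
      linarith
    have h1 := hf.volume_mul_le_setIntegral hd hs hL x hr0
    have h2 : ∫ u in Metric.closedBall x r, f u ≤ I :=
      setIntegral_mono_set
        ((hf.continuous hs hL).continuousOn.integrableOn_compact (isCompact_closedBall x t))
        (Filter.Eventually.of_forall hf0) (Metric.closedBall_subset_closedBall hrt).eventuallyLE
    have hLr : L * r ^ s = f x / 2 := by
      rw [hrs]
      field_simp
    have hrd : r ^ d = f x ^ (d / s : ℝ) / (2 * L) ^ (d / s : ℝ) := by
      rw [hr, ← rpow_natCast, ← rpow_mul (by positivity), one_div_mul_eq_div,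
        div_rpow hx.le (by positivity)]
    have h3 : f x ^ ((s + d) / s) ≤ K * I := by
      have h4 := h1.trans h2
      rw [hLr, hrd, ← hVdef] at h4
      rw [add_div, div_self hs.ne', rpow_add hx, rpow_one, hK]
      calc f x * f x ^ (d / s : ℝ) = 2 * (2 * L) ^ (d / s : ℝ) / V *
            (V * (f x ^ (d / s : ℝ) / (2 * L) ^ (d / s : ℝ)) * (f x - f x / 2)) := by
            field_simp
            ring
        _ ≤ _ := by gcongr
    have h5 : f x ≤ K ^ (s / (s + d)) * I ^ (s / (s + d)) := by
      rw [← mul_rpow hK0.le hI0]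
      calc f x = (f x ^ ((s + d) / s)) ^ (s / (s + d)) := by
            rw [← rpow_mul hx.le, div_mul_div_cancel₀ hs.ne', div_self (by positivity), rpow_one]
        _ ≤ _ := by gcongr
    have h6 : K ^ (s / (s + d)) * I ^ (s / (s + d)) ≤
        K ^ (s / (s + d)) * max (ballAvg d f t x) (I ^ (s / (s + d))) := by
      gcongr
      exact le_max_right _ _
    have h7 := hB0.trans (le_max_left (ballAvg d f t x) (I ^ (s / (s + d))))
    linarith

end
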